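/- Fix α ∈ (0,1) and let F be an absolutely continuous probability distribution on ℝ with continuous density f, strictly positive at q = F^{-1}(1−α). For each integer N ≥ 2, let n_N be binomial with parameters N and 1−α, and conditionally on n_N = n with 1 ≤ n ≤ N−1, let R_N be distributed as the spacing Z_(n+1) − Z_(n) of an i.i.d. N-sample from F. Then, as N → ∞, N · R_N converges in distribution to the exponential distribution with parameter f(q); in particular the random binomial index yields the same weak limit as a deterministic index sequence n_N with n_N/N → 1−α. -/

import Mathlib

open MeasureTheory ProbabilityTheory Filter Topology

theorem nullMeasurableSet_of_measure_add_compl_le {Ω : Type*} [MeasurableSpace Ω]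
    {μ : Measure Ω} [IsFiniteMeasure μ] {A : Set Ω} (h : μ A + μ Aᶜ ≤ μ Set.univ) :
    NullMeasurableSet A μ := by
  have hcover : toMeasurable μ A ∪ toMeasurable μ Aᶜ = Set.univ :=
    Set.eq_univ_of_univ_subset <| (Set.union_compl_self A).symm.subset.trans <|
      Set.union_subset_union (subset_toMeasurable μ A) (subset_toMeasurable μ Aᶜ)
  have hinter : μ (toMeasurable μ A ∩ toMeasurable μ Aᶜ) = 0 := by
    have hsum := measure_union_add_inter (μ := μ) (toMeasurable μ A)
      (measurableSet_toMeasurable μ Aᶜ)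
    rw [hcover, measure_toMeasurable, measure_toMeasurable] at hsum
    rw [← hsum] at h
    simpa using (ENNReal.add_le_add_iff_left (measure_ne_top μ Set.univ)).1
      (h.trans_eq (add_zero _).symm)
  have hdiff : μ (toMeasurable μ A \ A) = 0 :=
    measure_mono_null
      (Set.inter_subset_inter_right _ (subset_toMeasurable μ Aᶜ)) hinter
  refine (measurableSet_toMeasurable μ A).nullMeasurableSet.congr ?_
  exact (subset_toMeasurable μ A).eventuallyLE.antisymm (ae_le_set.2 hdiff) |>.symm

theorem measure_eq_sum_inter_fiber {Ω : Type*} [MeasurableSpace Ω] {μ : Measure Ω}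
    [IsProbabilityMeasure μ] {X : Ω → ℕ} {s : Finset ℕ}
    (h0 : ∀ j ∉ s, μ {ω | X ω = j} = 0) (h1 : ∑ j ∈ s, μ {ω | X ω = j} ≤ 1) (S : Set Ω) :
    μ S = ∑ j ∈ s, μ (S ∩ {ω | X ω = j}) := by
  have hnull (j : ℕ) : NullMeasurableSet {ω | X ω = j} μ := by
    refine nullMeasurableSet_of_measure_add_compl_le ?_
    have hcompl : {ω | X ω = j}ᶜ ⊆ ⋃ i : ℕ, if i = j then ∅ else {ω | X ω = i} := by
      intro ω hω
      refine Set.mem_iUnion.2 ⟨X ω, ?_⟩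
      have hne : X ω ≠ j := hω
      simp [hne]
    calc μ {ω | X ω = j} + μ {ω | X ω = j}ᶜ
        ≤ μ {ω | X ω = j} + ∑' i : ℕ, if i = j then 0 else μ {ω | X ω = i} := by
          gcongr
          refine (measure_mono hcompl).trans ((measure_iUnion_le _).trans_eq ?_)
          exact tsum_congr fun i => by split_ifs <;> simp
      _ = ∑' i : ℕ, μ {ω | X ω = i} := by
          rw [ENNReal.tsum_eq_add_tsum_ite (f := fun i => μ {ω | X ω = i}) j]
          congr!
      _ = ∑ i ∈ s, μ {ω | X ω = i} := tsum_eq_sum fun i hi => h0 i hi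
      _ ≤ μ Set.univ := by simpa using h1
  have hsplit (T : Set Ω) : T = ⋃ j : ℕ, T ∩ {ω | X ω = j} := by ext ω; simp
  have htsum : ∑' j : ℕ, μ (S ∩ {ω | X ω = j}) = ∑ j ∈ s, μ (S ∩ {ω | X ω = j}) :=
    tsum_eq_sum fun j hj => measure_mono_null Set.inter_subset_right (h0 j hj)
  rw [← htsum]
  refine le_antisymm ?_ ?_
  · conv_lhs => rw [hsplit S]
    exact measure_iUnion_le _
  · calc ∑' j : ℕ, μ (S ∩ {ω | X ω = j})
        ≤ ∑' j : ℕ, μ (toMeasurable μ S ∩ {ω | X ω = j}) := by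
          gcongr
          exact subset_toMeasurable μ S
      _ = μ (toMeasurable μ S) := by
          conv_rhs => rw [hsplit (toMeasurable μ S)]
          refine (measure_iUnion₀ (fun i j hij => Disjoint.aedisjoint ?_) fun j =>
            (measurableSet_toMeasurable μ S).nullMeasurableSet.inter (hnull j)).symm
          refine Set.disjoint_left.2 fun ω hi hj => hij ?_
          exact hi.2.symm.trans hj.2
      _ = μ S := measure_toMeasurable S

theorem hasDerivAt_integral_Iic {f F : ℝ → ℝ} (hfc : Continuous f) (hfi : Integrable f)
    (hF : ∀ x, F x = ∫ u in Set.Iic x, f u) (x : ℝ) : HasDerivAt F (f x) x := by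
  have heq : F = fun y => F 0 + ∫ u in (0 : ℝ)..y, f u := by
    funext y
    rw [hF, hF, ← intervalIntegral.integral_Iic_sub_Iic hfi.integrableOn hfi.integrableOn]
    ring
  rw [heq]
  exact (intervalIntegral.integral_hasDerivAt_right (hfc.intervalIntegrable 0 x)
    hfc.stronglyMeasurable.stronglyMeasurableAtFilter hfc.continuousAt).const_add (F 0)

/-- A distribution function on the real line with continuous density `f`. -/
structure HasContinuousDensity (F f : ℝ → ℝ) : Prop where
  nonneg (x : ℝ) : 0 ≤ f x
  continuous : Continuous f
  integrable : Integrable f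
  hasDerivAt (x : ℝ) : HasDerivAt F (f x) x
  tendsto_atBot : Tendsto F atBot (𝓝 0)
  tendsto_atTop : Tendsto F atTop (𝓝 1)

namespace HasContinuousDensity

variable {F f : ℝ → ℝ}

theorem of_integral_eq_one (hf0 : ∀ x, 0 ≤ f x) (hf1 : ∫ x, f x = 1) (hfc : Continuous f)
    (hF : ∀ x, F x = ∫ u in Set.Iic x, f u) : HasContinuousDensity F f := by
  have hfi : Integrable f := integrable_of_integral_eq_one hf1
  refine ⟨hf0, hfc, hfi, hasDerivAt_integral_Iic hfc hfi hF, ?_, ?_⟩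
  · have hcompl : F = fun x => 1 - ∫ u in Set.Ioi x, f u := by
      funext x
      rw [hF, ← hf1, ← integral_add_compl (measurableSet_Iic (a := x)) hfi, Set.compl_Iic]
      ring
    have hlim := (aecover_Ioi (μ := volume) tendsto_id).integral_tendsto_of_countably_generated
      (l := (atBot : Filter ℝ)) hfi
    rw [hf1] at hlim
    rw [hcompl]
    simpa using hlim.const_sub 1
  · have hlim := (aecover_Iic (μ := volume) tendsto_id).integral_tendsto_of_countably_generated
      (l := (atTop : Filter ℝ)) hfi
    rw [hf1] at hlim
    rw [funext hF]
    exact hlim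

theorem continuous_cdf (h : HasContinuousDensity F f) : Continuous F :=
  continuous_iff_continuousAt.2 fun x => (h.hasDerivAt x).continuousAt

theorem monotone (h : HasContinuousDensity F f) : Monotone F :=
  monotone_of_hasDerivAt_nonneg h.hasDerivAt h.nonneg

theorem cdf_nonneg (h : HasContinuousDensity F f) (x : ℝ) : 0 ≤ F x :=
  h.monotone.le_of_tendsto h.tendsto_atBot x

theorem cdf_le_one (h : HasContinuousDensity F f) (x : ℝ) : F x ≤ 1 :=
  h.monotone.ge_of_tendsto h.tendsto_atTop x

theorem integrable_mul (h : HasContinuousDensity F f) {g : ℝ → ℝ} (hg : Continuous g)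
    (hg1 : ∀ x, |g x| ≤ 1) : Integrable fun x => g x * f x :=
  h.integrable.bdd_mul (c := 1) hg.aestronglyMeasurable (ae_of_all _ hg1)

theorem integrable_pow_mul_pow (h : HasContinuousDensity F f) (a b : ℕ) :
    Integrable fun x => F x ^ a * (1 - F x) ^ b * f x := by
  have hc := h.continuous_cdf
  refine h.integrable_mul (by fun_prop) fun x => ?_
  have h0 := h.cdf_nonneg x
  have h1 := h.cdf_le_one x
  rw [abs_mul, abs_pow, abs_pow, abs_of_nonneg h0, abs_of_nonneg (sub_nonneg.2 h1)]
  exact mul_le_one₀ (pow_le_one₀ h0 h1) (by positivity [sub_nonneg.2 h1])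
    (pow_le_one₀ (by linarith) (by linarith))

theorem integral_pow_mul_pow (h : HasContinuousDensity F f) (a b : ℕ) :
    ∫ x, F x ^ a * (1 - F x) ^ b * f x
      = (a.factorial : ℝ) * b.factorial / (a + b + 1).factorial := by
  induction b generalizing a with
  | zero =>
    have hint := integral_of_hasDerivAt_of_tendsto (fun x => (h.hasDerivAt x).pow (a + 1))
      (by simpa [mul_assoc] using (h.integrable_pow_mul_pow a 0).const_mul ((a : ℝ) + 1))
      (h.tendsto_atBot.pow (a + 1)) (h.tendsto_atTop.pow (a + 1))
    simp only [Nat.cast_add, Nat.cast_one, add_tsub_cancel_right, mul_assoc,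
      integral_const_mul] at hint
    simp only [pow_zero, Nat.factorial_zero, Nat.cast_one, add_zero, mul_one,
      Nat.factorial_succ, Nat.cast_mul, Nat.cast_add]
    have ha : (a.factorial : ℝ) ≠ 0 := by positivity
    simp at hint
    field_simp
    linarith
  | succ b ih =>
    have hint := integral_of_hasDerivAt_of_tendsto
      (f' := fun x => ((a : ℝ) + 1) * (F x ^ a * (1 - F x) ^ (b + 1) * f x)
        - ((b : ℝ) + 1) * (F x ^ (a + 1) * (1 - F x) ^ b * f x))
      (fun x => (((h.hasDerivAt x).pow (a + 1)).mul
        (((h.hasDerivAt x).const_sub 1).pow (b + 1))).congr_deriv (by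
          push_cast
          simp only [Pi.pow_apply]
          ring))
      (((h.integrable_pow_mul_pow a (b + 1)).const_mul _).sub
        ((h.integrable_pow_mul_pow (a + 1) b).const_mul _))
      ((h.tendsto_atBot.pow (a + 1)).mul ((h.tendsto_atBot.const_sub 1).pow (b + 1)))
      ((h.tendsto_atTop.pow (a + 1)).mul ((h.tendsto_atTop.const_sub 1).pow (b + 1)))
    rw [integral_sub ((h.integrable_pow_mul_pow a (b + 1)).const_mul _)
      ((h.integrable_pow_mul_pow (a + 1) b).const_mul _), integral_const_mul, integral_const_mul,
      ih (a + 1)] at hint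
    have hidx : a + 1 + b + 1 = a + (b + 1) + 1 := by ring
    rw [hidx, Nat.factorial_succ a] at hint
    rw [Nat.factorial_succ b]
    have hfac : ((a + (b + 1) + 1).factorial : ℝ) ≠ 0 := by positivity
    push_cast at hint ⊢
    simp at hint
    have ha : (a : ℝ) + 1 ≠ 0 := by positivity
    apply mul_left_cancel₀ ha
    linear_combination hint

/-- The spacing density integrand is integrable as a function of location and spacing. -/
theorem integrable_spacing (h : HasContinuousDensity F f) (a m : ℕ) :
    Integrable (fun z : ℝ × ℝ =>
      F z.1 ^ a * f z.1 * f (z.1 + z.2) * (1 - F (z.1 + z.2)) ^ m)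
      ((volume : Measure ℝ).prod volume) := by
  have hp := (h.integrable_pow_mul_pow a 0).mul_prod (h.integrable_pow_mul_pow 0 m)
  refine ((measurePreserving_prod_add (volume : Measure ℝ) volume).integrable_comp_of_integrable
    hp).congr (ae_of_all _ fun z => ?_)
  simp only [Function.comp_apply, pow_zero]
  ring

theorem setIntegral_spacing (h : HasContinuousDensity F f) (m : ℕ) {y : ℝ} (hy : 0 ≤ y) (u : ℝ) :
    ∫ δ in Set.Ioc 0 y, f (u + δ) * (1 - F (u + δ)) ^ m
      = ((1 - F u) ^ (m + 1) - (1 - F (u + y)) ^ (m + 1)) / (m + 1) := by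
  have hc := h.continuous_cdf
  have hfc := h.continuous
  rw [← intervalIntegral.integral_of_le hy, intervalIntegral.integral_eq_sub_of_hasDerivAt
    (f := fun δ => -((1 - F (u + δ)) ^ (m + 1) / (m + 1)))]
  · simp only [add_zero]
    ring
  · intro δ _
    have hd := (((h.hasDerivAt (u + δ)).comp_const_add u δ).const_sub 1).pow (m + 1)
    refine (hd.div_const ((m : ℝ) + 1)).neg.congr_deriv ?_
    have hm : (m : ℝ) + 1 ≠ 0 := by positivity
    push_cast
    field_simp
  · exact Continuous.intervalIntegrable (by fun_prop) _ _

theorem integrable_pow_mul_shift_pow (h : HasContinuousDensity F f) (a b : ℕ) (y : ℝ) :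
    Integrable fun x => F x ^ a * (1 - F (x + y)) ^ b * f x := by
  have hc := h.continuous_cdf
  refine h.integrable_mul (by fun_prop) fun x => ?_
  have h0 := h.cdf_nonneg x
  have h1 := h.cdf_le_one (x + y)
  have h2 := h.cdf_nonneg (x + y)
  rw [abs_mul, abs_pow, abs_pow, abs_of_nonneg h0, abs_of_nonneg (sub_nonneg.2 h1)]
  exact mul_le_one₀ (pow_le_one₀ h0 (h.cdf_le_one x)) (pow_nonneg (sub_nonneg.2 h1) b)
    (pow_le_one₀ (by linarith) (by linarith))

/-- The distribution function of a spacing, for `a` points below it and `m` points above it. -/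
theorem spacing_cdf (h : HasContinuousDensity F f) (a m : ℕ) {y : ℝ} (hy : 0 ≤ y) :
    ∫ δ in Set.Iic y, (Set.Ioi (0 : ℝ)).indicator (fun δ =>
      (((a + m + 2).factorial : ℝ) / ((a.factorial : ℝ) * (m.factorial : ℝ))) *
        ∫ u : ℝ, F u ^ a * f u * f (u + δ) * (1 - F (u + δ)) ^ m) δ
      = 1 - ((a + m + 2).factorial : ℝ) / ((a.factorial : ℝ) * ((m + 1).factorial : ℝ)) *
        ∫ u : ℝ, F u ^ a * (1 - F (u + y)) ^ (m + 1) * f u := by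
  rw [setIntegral_indicator measurableSet_Ioi, Set.Iic_inter_Ioi, integral_const_mul,
    ← integral_integral_swap (f := fun u δ => F u ^ a * f u * f (u + δ) * (1 - F (u + δ)) ^ m)]
  · have hinner (u : ℝ) : ∫ δ in Set.Ioc 0 y, F u ^ a * f u * f (u + δ) * (1 - F (u + δ)) ^ m
        = (F u ^ a * (1 - F u) ^ (m + 1) * f u - F u ^ a * (1 - F (u + y)) ^ (m + 1) * f u)
          / (m + 1) := by
      simp only [mul_assoc (F u ^ a * f u)]
      rw [integral_const_mul, h.setIntegral_spacing m hy u]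
      ring
    rw [integral_congr_ae (ae_of_all _ hinner)]
    rw [integral_div, integral_sub (h.integrable_pow_mul_pow a (m + 1))
      (h.integrable_pow_mul_shift_pow a (m + 1) y), h.integral_pow_mul_pow,
      Nat.factorial_succ m]
    have ha : (a.factorial : ℝ) ≠ 0 := by positivity
    have hm : (m.factorial : ℝ) ≠ 0 := by positivity
    have hN : ((a + m + 2).factorial : ℝ) ≠ 0 := by positivity
    have hidx : a + (m + 1) + 1 = a + m + 2 := by ring
    rw [hidx]
    have hm1 : (m : ℝ) + 1 ≠ 0 := by positivity
    push_cast
    field_simp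
  · have hi := (h.integrable_spacing a m).integrableOn (s := Set.univ ×ˢ Set.Ioc 0 y)
    rwa [IntegrableOn, ← Measure.prod_restrict, Measure.restrict_univ] at hi

theorem exists_le_abs_sub_of_notMem (h : HasContinuousDensity F f) {q : ℝ} (hq : 0 < f q)
    {U : Set ℝ} (hU : U ∈ 𝓝 q) : ∃ δ > 0, ∀ u ∉ U, δ ≤ |F u - F q| := by
  have hpos : ∀ᶠ u in 𝓝 q, 0 < f u := h.continuous.continuousAt.eventually_const_lt hq
  obtain ⟨r, hr, hball⟩ := Metric.nhds_basis_closedBall.mem_iff.1 (inter_mem hU hpos)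
  rw [Real.closedBall_eq_Icc] at hball
  have hmono : StrictMonoOn F (Set.Icc (q - r) (q + r)) := by
    refine strictMonoOn_of_deriv_pos (convex_Icc _ _) h.continuous_cdf.continuousOn fun u hu => ?_
    rw [(h.hasDerivAt u).deriv]
    exact (hball (interior_subset hu)).2
  have hleft : F (q - r) < F q :=
    hmono ⟨le_rfl, by linarith⟩ ⟨by linarith, by linarith⟩ (by linarith)
  have hright : F q < F (q + r) :=
    hmono ⟨by linarith, by linarith⟩ ⟨by linarith, le_rfl⟩ (by linarith)
  refine ⟨min (F q - F (q - r)) (F (q + r) - F q),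
    lt_min (sub_pos.2 hleft) (sub_pos.2 hright), fun u hu => ?_⟩
  have hnot : u ∉ Set.Icc (q - r) (q + r) := fun hmem => hu (hball hmem).1
  rcases lt_or_ge u (q - r) with hlt | hge
  · refine (min_le_left _ _).trans ((le_abs_self _).trans' ?_ |>.trans_eq (abs_sub_comm _ _))
    linarith [h.monotone hlt.le]
  · have hlt : q + r < u := not_le.1 fun hle => hnot ⟨hge, hle⟩
    refine (min_le_right _ _).trans ((le_abs_self _).trans' ?_)
    linarith [h.monotone hlt.le]

theorem hasStrictDerivAt_log_one_sub (h : HasContinuousDensity F f) {q : ℝ} (hq : F q < 1) :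
    HasStrictDerivAt (fun u => Real.log (1 - F u)) (-f q / (1 - F q)) q :=
  (((hasStrictDerivAt_of_hasDerivAt_of_continuousAt (.of_forall h.hasDerivAt)
    h.continuous.continuousAt).const_sub 1).log (sub_pos.2 hq).ne')

section Limits

variable {ι : Type*} {l : Filter ι} {N n : ι → ℕ} {q : ℝ}

theorem tendsto_shift_nhds (hN : Tendsto N l atTop) (x : ℝ) :
    Tendsto (fun z : ι × ℝ => z.2 + x / N z.1) (l ×ˢ 𝓝 q) (𝓝 q) := by
  have hdiv : Tendsto (fun i => x / (N i : ℝ)) l (𝓝 0) :=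
    (tendsto_const_div_atTop_nhds_zero_nat x).comp hN
  simpa using tendsto_snd.add (hdiv.comp tendsto_fst)

theorem tendsto_mul_log_sub_log (h : HasContinuousDensity F f) (hq : F q < 1)
    (hN : Tendsto N l atTop) (x : ℝ) :
    Tendsto (fun z : ι × ℝ =>
      (N z.1 : ℝ) * (Real.log (1 - F (z.2 + x / N z.1)) - Real.log (1 - F z.2)))
      (l ×ˢ 𝓝 q) (𝓝 (x * (-f q / (1 - F q)))) := by
  have hpair : Tendsto (fun z : ι × ℝ => (z.2 + x / N z.1, z.2)) (l ×ˢ 𝓝 q) (𝓝 (q, q)) :=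
    (tendsto_shift_nhds hN x).prodMk_nhds tendsto_snd
  have ho := ((h.hasStrictDerivAt_log_one_sub hq).isLittleO.comp_tendsto hpair)
  have hmul := (Asymptotics.isBigO_refl (fun z : ι × ℝ => (N z.1 : ℝ)) (l ×ˢ 𝓝 q)).mul_isLittleO ho
  have hpos : ∀ᶠ z : ι × ℝ in l ×ˢ 𝓝 q, (N z.1 : ℝ) ≠ 0 :=
    (hN.comp tendsto_fst).eventually_ne_atTop 0 |>.mono fun z hz => Nat.cast_ne_zero.2 hz
  have hbound : (fun z : ι × ℝ => (N z.1 : ℝ) * (z.2 + x / N z.1 - z.2))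
      =O[l ×ˢ 𝓝 q] fun _ => (1 : ℝ) := by
    refine (Asymptotics.isBigO_const_const x one_ne_zero _).congr' ?_ EventuallyEq.rfl
    filter_upwards [hpos] with z hz
    field_simp
    ring
  have hzero := (Asymptotics.isLittleO_one_iff ℝ).1 (hmul.trans_isBigO hbound)
  have hlim := hzero.add_const (x * (-f q / (1 - F q)))
  rw [zero_add] at hlim
  refine hlim.congr' ?_
  filter_upwards [hpos] with z hz
  simp only [Function.comp_apply, ContinuousLinearMap.toSpanSingleton_apply, smul_eq_mul,
    add_sub_cancel_left]
  field_simp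
  ring

theorem tendsto_ratio_pow (h : HasContinuousDensity F f) (hq : F q < 1)
    (hN : Tendsto N l atTop) (hn : Tendsto (fun i => (n i : ℝ) / N i) l (𝓝 (F q)))
    (hle : ∀ᶠ i in l, n i ≤ N i) (x : ℝ) :
    Tendsto (fun z : ι × ℝ =>
      ((1 - F (z.2 + x / N z.1)) / (1 - F z.2)) ^ (N z.1 - n z.1))
      (l ×ˢ 𝓝 q) (𝓝 (Real.exp (-(f q * x)))) := by
  have hlim := (((hn.comp tendsto_fst).const_sub 1).mul
    (h.tendsto_mul_log_sub_log hq hN x)).rexp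
  have hval : (1 - F q) * (x * (-f q / (1 - F q))) = -(f q * x) := by
    have hne := (sub_pos.2 hq).ne'
    field_simp
  rw [hval] at hlim
  refine hlim.congr' ?_
  have hlt : ∀ᶠ u in 𝓝 q, F u < 1 := h.continuous_cdf.continuousAt.eventually_lt_const hq
  filter_upwards [tendsto_snd.eventually hlt, (tendsto_shift_nhds hN x).eventually hlt,
    tendsto_fst.eventually hle,
    (hN.comp tendsto_fst).eventually_ne_atTop 0] with z h1 h2 hnN hN0
  have hN0' : (N z.1 : ℝ) ≠ 0 := Nat.cast_ne_zero.2 hN0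
  rw [← Real.log_div (sub_pos.2 h2).ne' (sub_pos.2 h1).ne', ← mul_assoc]
  have hcoef : (1 - ((fun i => (n i : ℝ) / N i) ∘ Prod.fst) z) * (N z.1 : ℝ)
      = ((N z.1 - n z.1 : ℕ) : ℝ) := by
    rw [Nat.cast_sub hnN]
    simp only [Function.comp_apply]
    field_simp
  rw [hcoef, Real.exp_nat_mul, Real.exp_log (div_pos (sub_pos.2 h2) (sub_pos.2 h1))]

theorem integrable_pow_mul_pow_mul_sq (h : HasContinuousDensity F f) (a b : ℕ) (p : ℝ) :
    Integrable fun u => F u ^ a * (1 - F u) ^ b * f u * (F u - p) ^ 2 := by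
  refine (((h.integrable_pow_mul_pow (a + 2) b).sub
    ((h.integrable_pow_mul_pow (a + 1) b).const_mul (2 * p))).add
    ((h.integrable_pow_mul_pow a b).const_mul (p ^ 2))).congr (ae_of_all _ fun u => ?_)
  simp only [Pi.add_apply, Pi.sub_apply]
  ring

theorem integral_pow_mul_pow_mul_sq (h : HasContinuousDensity F f) (a b : ℕ) (p : ℝ) :
    ((a + b + 1).factorial : ℝ) / ((a.factorial : ℝ) * (b.factorial : ℝ)) *
      ∫ u, F u ^ a * (1 - F u) ^ b * f u * (F u - p) ^ 2
      = ((a : ℝ) + 1) * (a + 2) / ((a + b + 2) * (a + b + 3))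
        - 2 * p * ((a + 1) / (a + b + 2)) + p ^ 2 := by
  have hsplit (u : ℝ) : F u ^ a * (1 - F u) ^ b * f u * (F u - p) ^ 2
      = F u ^ (a + 2) * (1 - F u) ^ b * f u
        - 2 * p * (F u ^ (a + 1) * (1 - F u) ^ b * f u)
        + p ^ 2 * (F u ^ a * (1 - F u) ^ b * f u) := by ring
  have hsub : Integrable fun u => F u ^ (a + 2) * (1 - F u) ^ b * f u
      - 2 * p * (F u ^ (a + 1) * (1 - F u) ^ b * f u) :=
    (h.integrable_pow_mul_pow (a + 2) b).sub
      ((h.integrable_pow_mul_pow (a + 1) b).const_mul (2 * p))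
  rw [integral_congr_ae (ae_of_all _ hsplit), integral_add hsub
      ((h.integrable_pow_mul_pow a b).const_mul (p ^ 2)),
    integral_sub (h.integrable_pow_mul_pow (a + 2) b)
      ((h.integrable_pow_mul_pow (a + 1) b).const_mul (2 * p)),
    integral_const_mul, integral_const_mul, h.integral_pow_mul_pow, h.integral_pow_mul_pow,
    h.integral_pow_mul_pow]
  have h2 : a + 2 + b + 1 = (a + b + 1) + 1 + 1 := by ring
  have h1 : a + 1 + b + 1 = (a + b + 1) + 1 := by ring
  rw [h2, h1, Nat.factorial_succ (a + b + 1 + 1), Nat.factorial_succ (a + b + 1),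
    Nat.factorial_succ (a + 1), Nat.factorial_succ a]
  have hA : (a.factorial : ℝ) ≠ 0 := by positivity
  have hB : (b.factorial : ℝ) ≠ 0 := by positivity
  have hC : ((a + b + 1).factorial : ℝ) ≠ 0 := by positivity
  have hD : (a : ℝ) + b + 2 ≠ 0 := by positivity
  have hE : (a : ℝ) + b + 3 ≠ 0 := by positivity
  push_cast
  have hD' : (a : ℝ) + b + 1 + 1 = a + b + 2 := by ring
  have hE' : (a : ℝ) + b + 1 + 1 + 1 = a + b + 3 := by ring
  rw [hE', hD']
  field_simp
  ring

theorem eventually_one_le_lt (hN : Tendsto N l atTop) {p : ℝ} (hp : p ∈ Set.Ioo (0 : ℝ) 1)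
    (hn : Tendsto (fun i => (n i : ℝ) / N i) l (𝓝 p)) : ∀ᶠ i in l, 1 ≤ n i ∧ n i < N i := by
  filter_upwards [hn.eventually_const_lt hp.1, hn.eventually_lt_const hp.2,
    hN.eventually_gt_atTop 0] with i h0 h1 hpos
  have hpos' : (0 : ℝ) < N i := Nat.cast_pos.2 hpos
  rw [div_lt_one hpos'] at h1
  refine ⟨Nat.one_le_iff_ne_zero.2 fun hz => ?_, by exact_mod_cast h1⟩
  simp [hz] at h0

theorem tendsto_integral_sq (h : HasContinuousDensity F f) (hN : Tendsto N l atTop)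
    {p : ℝ} (hp : p ∈ Set.Ioo (0 : ℝ) 1)
    (hn : Tendsto (fun i => (n i : ℝ) / N i) l (𝓝 p)) :
    Tendsto (fun i => ((N i).factorial : ℝ) /
        (((n i - 1).factorial : ℝ) * ((N i - n i).factorial : ℝ)) *
      ∫ u, F u ^ (n i - 1) * (1 - F u) ^ (N i - n i) * f u * (F u - p) ^ 2) l (𝓝 0) := by
  have hinv : Tendsto (fun i => (1 : ℝ) / N i) l (𝓝 0) :=
    (tendsto_const_div_atTop_nhds_zero_nat (1 : ℝ)).comp hN
  have hden (c : ℝ) : Tendsto (fun i => 1 + c * ((1 : ℝ) / N i)) l (𝓝 1) := by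
    simpa using (hinv.const_mul c).const_add 1
  have hlim := (((hn.mul (hn.add hinv)).div ((hden 1).mul (hden 2)) (by norm_num)).sub
    ((hn.div (hden 1) one_ne_zero).const_mul (2 * p))).add_const (p ^ 2)
  have hval : p * (p + 0) / (1 * 1) - 2 * p * (p / 1) + p ^ 2 = 0 := by ring
  rw [hval] at hlim
  refine hlim.congr' ?_
  filter_upwards [eventually_one_le_lt hN hp hn] with i ⟨h1, h2⟩
  obtain ⟨a, ha⟩ : ∃ a, n i = a + 1 := ⟨n i - 1, by omega⟩
  obtain ⟨b, hb⟩ : ∃ b, N i = a + b + 1 := ⟨N i - n i, by omega⟩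
  have hidx : N i - n i = b := by omega
  simp only [Pi.div_apply]
  rw [hidx, ha, hb, Nat.add_sub_cancel, h.integral_pow_mul_pow_mul_sq]
  push_cast
  have hD : (a : ℝ) + b + 1 ≠ 0 := by positivity
  have hE : (a : ℝ) + b + 2 ≠ 0 := by positivity
  have hG : (a : ℝ) + b + 3 ≠ 0 := by positivity
  have e1 : 1 + 1 * (1 / ((a : ℝ) + b + 1)) = (a + b + 2) / (a + b + 1) := by field_simp; ring
  have e2 : 1 + 2 * (1 / ((a : ℝ) + b + 1)) = (a + b + 3) / (a + b + 1) := by field_simp; ring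
  rw [e1, e2]
  field_simp
  ring

theorem abs_pow_shift_sub_le (h : HasContinuousDensity F f) {a b : ℕ} (hb : b ≠ 0)
    {y L η δ : ℝ} (hy : 0 ≤ y) (hL : L ∈ Set.Icc (0 : ℝ) 1) (hη : 0 ≤ η) (hδ : 0 < δ) {p u : ℝ}
    (hu : |((1 - F (u + y)) / (1 - F u)) ^ b - L| ≤ η ∨ δ ≤ |F u - p|) :
    |F u ^ a * (1 - F (u + y)) ^ b * f u - L * (F u ^ a * (1 - F u) ^ b * f u)|
      ≤ η * (F u ^ a * (1 - F u) ^ b * f u)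
        + (δ ^ 2)⁻¹ * (F u ^ a * (1 - F u) ^ b * f u * (F u - p) ^ 2) := by
  have hs0 : 0 ≤ (1 - F (u + y)) ^ b := pow_nonneg (sub_nonneg.2 (h.cdf_le_one _)) b
  have hst : (1 - F (u + y)) ^ b ≤ (1 - F u) ^ b :=
    pow_le_pow_left₀ (sub_nonneg.2 (h.cdf_le_one _))
      (sub_le_sub_left (h.monotone (le_add_of_nonneg_right hy)) 1) b
  have hcoef : 0 ≤ F u ^ a * f u := mul_nonneg (pow_nonneg (h.cdf_nonneg u) a) (h.nonneg u)
  have key : |(1 - F (u + y)) ^ b - L * (1 - F u) ^ b|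
      ≤ η * (1 - F u) ^ b + (δ ^ 2)⁻¹ * ((1 - F u) ^ b * (F u - p) ^ 2) := by
    have ht0 := hs0.trans hst
    rcases hu with hu | hu
    · have hsq : 0 ≤ (δ ^ 2)⁻¹ * ((1 - F u) ^ b * (F u - p) ^ 2) := by positivity
      refine le_add_of_le_of_nonneg ?_ hsq
      rcases (h.cdf_le_one u).eq_or_lt with h1 | h1
      · have hz : (1 - F u) ^ b = 0 := by rw [h1, sub_self, zero_pow hb]
        rw [hz] at hst ⊢
        simp [le_antisymm hst hs0]
      · have hpos : 0 < (1 - F u) ^ b := pow_pos (sub_pos.2 h1) b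
        have hfac : (1 - F (u + y)) ^ b - L * (1 - F u) ^ b
            = (((1 - F (u + y)) / (1 - F u)) ^ b - L) * (1 - F u) ^ b := by
          rw [div_pow, sub_mul, div_mul_cancel₀ _ hpos.ne']
        rw [hfac, abs_mul, abs_of_pos hpos]
        exact mul_le_mul_of_nonneg_right hu hpos.le
    · have hone : 1 ≤ (δ ^ 2)⁻¹ * (F u - p) ^ 2 := by
        rw [inv_mul_eq_div, one_le_div (by positivity), ← sq_abs (F u - p)]
        exact pow_le_pow_left₀ hδ.le hu 2
      have hLt : L * (1 - F u) ^ b ≤ (1 - F u) ^ b := mul_le_of_le_one_left ht0 hL.2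
      have hLt0 : 0 ≤ L * (1 - F u) ^ b := mul_nonneg hL.1 ht0
      calc |(1 - F (u + y)) ^ b - L * (1 - F u) ^ b| ≤ (1 - F u) ^ b :=
            abs_le.2 ⟨by linarith, by linarith⟩
        _ ≤ (1 - F u) ^ b * ((δ ^ 2)⁻¹ * (F u - p) ^ 2) := le_mul_of_one_le_right ht0 hone
        _ = (δ ^ 2)⁻¹ * ((1 - F u) ^ b * (F u - p) ^ 2) := by ring
        _ ≤ _ := le_add_of_nonneg_left (mul_nonneg hη ht0)
  calc |F u ^ a * (1 - F (u + y)) ^ b * f u - L * (F u ^ a * (1 - F u) ^ b * f u)|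
      = F u ^ a * f u * |(1 - F (u + y)) ^ b - L * (1 - F u) ^ b| := by
        rw [← abs_of_nonneg hcoef, ← abs_mul]
        congr 1
        ring
    _ ≤ F u ^ a * f u *
        (η * (1 - F u) ^ b + (δ ^ 2)⁻¹ * ((1 - F u) ^ b * (F u - p) ^ 2)) :=
        mul_le_mul_of_nonneg_left key hcoef
    _ = _ := by ring

theorem tendsto_spacing_survival (h : HasContinuousDensity F f)
    (hq : F q ∈ Set.Ioo (0 : ℝ) 1) (hfq : 0 < f q) (hN : Tendsto N l atTop)
    (hn : Tendsto (fun i => (n i : ℝ) / N i) l (𝓝 (F q))) {x : ℝ} (hx : 0 ≤ x) :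
    Tendsto (fun i => ((N i).factorial : ℝ) /
        (((n i - 1).factorial : ℝ) * ((N i - n i).factorial : ℝ)) *
      ∫ u, F u ^ (n i - 1) * (1 - F (u + x / N i)) ^ (N i - n i) * f u) l
      (𝓝 (Real.exp (-(f q * x)))) := by
  have hidx := eventually_one_le_lt hN hq hn
  set L := Real.exp (-(f q * x))
  have hL : L ∈ Set.Icc (0 : ℝ) 1 :=
    ⟨(Real.exp_pos _).le, Real.exp_le_one_iff.2 (neg_nonpos.2 (mul_nonneg hfq.le hx))⟩
  rw [Metric.tendsto_nhds]
  intro ε hε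
  have hclose := (h.tendsto_ratio_pow hq.2 hN hn (hidx.mono fun i hi => hi.2.le) x).eventually
    (Metric.closedBall_mem_nhds L (half_pos hε))
  obtain ⟨pl, hpl, pq, hpq, hprod⟩ := eventually_prod_iff.1 hclose
  obtain ⟨δ, hδ, hfar⟩ := h.exists_le_abs_sub_of_notMem hfq hpq
  have hsmall := (((h.tendsto_integral_sq hN hq hn).const_mul (δ ^ 2)⁻¹).eventually_lt_const
    (u := ε / 2) (by simpa using half_pos hε))
  filter_upwards [hidx, hpl, hsmall] with i hi hpi hvar
  obtain ⟨a, ha⟩ : ∃ a, n i = a + 1 := ⟨n i - 1, by omega⟩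
  obtain ⟨b, hb⟩ : ∃ b, N i = a + b + 1 := ⟨N i - n i, by omega⟩
  have hsub : N i - n i = b := by omega
  have hb0 : b ≠ 0 := by omega
  set y := x / (N i : ℝ)
  have hy : 0 ≤ y := div_nonneg hx (Nat.cast_nonneg _)
  have hest (u : ℝ) := h.abs_pow_shift_sub_le (a := a) (p := F q) (u := u) (η := ε / 2)
    hb0 hy hL (half_pos hε).le hδ <| by
      by_cases hu : pq u
      · left
        have := hprod hpi hu
        rwa [hsub, Real.dist_eq] at this
      · exact Or.inr (hfar u hu)
  rw [hsub, hb, ha, Nat.add_sub_cancel] at hvar ⊢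
  set K := ((a + b + 1).factorial : ℝ) / ((a.factorial : ℝ) * (b.factorial : ℝ)) with hK
  have hK0 : 0 ≤ K := by positivity
  have hmass : K * ∫ u, F u ^ a * (1 - F u) ^ b * f u = 1 := by
    rw [h.integral_pow_mul_pow, hK]
    have hA : (a.factorial : ℝ) ≠ 0 := by positivity
    have hB : (b.factorial : ℝ) ≠ 0 := by positivity
    have hC : ((a + b + 1).factorial : ℝ) ≠ 0 := by positivity
    field_simp
  have hint := h.integrable_pow_mul_pow a b
  have hintsq := h.integrable_pow_mul_pow_mul_sq a b (F q)
  have hbound : |(∫ u, F u ^ a * (1 - F (u + y)) ^ b * f u)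
        - L * ∫ u, F u ^ a * (1 - F u) ^ b * f u|
      ≤ ε / 2 * (∫ u, F u ^ a * (1 - F u) ^ b * f u)
        + (δ ^ 2)⁻¹ * ∫ u, F u ^ a * (1 - F u) ^ b * f u * (F u - F q) ^ 2 := by
    rw [← integral_const_mul, ← integral_const_mul, ← integral_const_mul,
      ← integral_sub (h.integrable_pow_mul_shift_pow a b y) (hint.const_mul L),
      ← integral_add (hint.const_mul _) (hintsq.const_mul _)]
    exact (abs_integral_le_integral_abs).trans (integral_mono
      ((h.integrable_pow_mul_shift_pow a b y).sub (hint.const_mul L)).abs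
      ((hint.const_mul _).add (hintsq.const_mul _)) hest)
  rw [Real.dist_eq]
  calc |K * (∫ u, F u ^ a * (1 - F (u + y)) ^ b * f u) - L|
      = K * |(∫ u, F u ^ a * (1 - F (u + y)) ^ b * f u)
        - L * ∫ u, F u ^ a * (1 - F u) ^ b * f u| := by
        rw [← abs_of_nonneg hK0, ← abs_mul, abs_of_nonneg hK0]
        congr 1
        linear_combination L * hmass
    _ ≤ K * (ε / 2 * (∫ u, F u ^ a * (1 - F u) ^ b * f u)
        + (δ ^ 2)⁻¹ * ∫ u, F u ^ a * (1 - F u) ^ b * f u * (F u - F q) ^ 2) :=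
        mul_le_mul_of_nonneg_left hbound hK0
    _ = ε / 2 + (δ ^ 2)⁻¹ *
        (K * ∫ u, F u ^ a * (1 - F u) ^ b * f u * (F u - F q) ^ 2) := by
        linear_combination (ε / 2) * hmass
    _ < ε := by linarith

/-- Normalized central spacings are asymptotically exponential. -/
theorem tendsto_spacing_cdf (h : HasContinuousDensity F f)
    (hq : F q ∈ Set.Ioo (0 : ℝ) 1) (hfq : 0 < f q) (hN : Tendsto N l atTop)
    (hn : Tendsto (fun i => (n i : ℝ) / N i) l (𝓝 (F q))) (x : ℝ) :
    Tendsto (fun i => ∫ δ in Set.Iic (x / N i), (Set.Ioi (0 : ℝ)).indicator (fun δ =>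
      (((N i).factorial : ℝ) / (((n i - 1).factorial : ℝ) * ((N i - n i - 1).factorial : ℝ))) *
        ∫ u : ℝ, F u ^ (n i - 1) * f u * f (u + δ) * (1 - F (u + δ)) ^ (N i - n i - 1)) δ) l
      (𝓝 ((expMeasure (f q) (Set.Iic x)).toReal)) := by
  have : IsProbabilityMeasure (expMeasure (f q)) := isProbabilityMeasure_expMeasure hfq
  have hcdf : (expMeasure (f q) (Set.Iic x)).toReal
      = if 0 ≤ x then 1 - Real.exp (-(f q * x)) else 0 := by
    rw [← cdf_expMeasure_eq hfq, cdf_eq_real, measureReal_def]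
  rw [hcdf]
  split_ifs with hx
  · refine ((h.tendsto_spacing_survival hq hfq hN hn hx).const_sub 1).congr' ?_
    filter_upwards [eventually_one_le_lt hN hq hn] with i hi
    obtain ⟨a, ha⟩ : ∃ a, n i = a + 1 := ⟨n i - 1, by omega⟩
    obtain ⟨m, hm⟩ : ∃ m, N i = a + m + 2 := ⟨N i - n i - 1, by omega⟩
    have hsub1 : N i - n i - 1 = m := by omega
    have hsub : N i - n i = m + 1 := by omega
    have hy : 0 ≤ x / (N i : ℝ) := div_nonneg hx (Nat.cast_nonneg _)
    have hspace := h.spacing_cdf a m hy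
    rw [hsub1, hsub]
    rw [← hm] at hspace
    rw [ha, Nat.add_sub_cancel, hspace]
  · refine tendsto_const_nhds.congr fun i => ?_
    have hy : x / (N i : ℝ) ≤ 0 :=
      div_nonpos_of_nonpos_of_nonneg (not_le.1 hx).le (Nat.cast_nonneg _)
    rw [setIntegral_indicator measurableSet_Ioi, Set.Iic_inter_Ioi, Set.Ioc_eq_empty hy.not_gt,
      setIntegral_empty]

end Limits

end HasContinuousDensity

theorem sum_binomial_mul_sq {p : ℝ} (hp : p ∈ Set.Icc (0 : ℝ) 1) {N : ℕ} (hN : N ≠ 0) :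
    ∑ j ∈ Finset.range (N + 1),
      (N.choose j : ℝ) * p ^ j * (1 - p) ^ (N - j) * ((j : ℝ) / N - p) ^ 2
      = p * (1 - p) / N := by
  have hvar := bernstein.variance hN ⟨p, hp⟩
  rw [Finset.sum_range, ← hvar]
  refine Finset.sum_congr rfl fun k _ => ?_
  simp only [bernstein_apply, bernstein.z]
  ring

theorem sum_binomial_eq_one (p : ℝ) (N : ℕ) :
    ∑ j ∈ Finset.range (N + 1), (N.choose j : ℝ) * p ^ j * (1 - p) ^ (N - j) = 1 := by
  have hsum := add_pow p (1 - p) N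
  rw [add_sub_cancel, one_pow] at hsum
  exact (hsum.trans (Finset.sum_congr rfl fun j _ => by ring)).symm

/-- A binomial mixture has the same limit as the components with index proportion tending
to the success probability. -/
theorem tendsto_binomial_mixture {p L : ℝ} (hp : p ∈ Set.Icc (0 : ℝ) 1)
    (hL : L ∈ Set.Icc (0 : ℝ) 1) {c : ℕ → ℕ → ℝ}
    (hc0 : ∀ᶠ N in atTop, ∀ j, 0 ≤ c N j)
    (hc1 : ∀ᶠ N in atTop, ∀ j, c N j ≤ (N.choose j : ℝ) * p ^ j * (1 - p) ^ (N - j))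
    {g : ℕ × ℕ → ℝ}
    (hg : Tendsto g (comap Prod.fst atTop ⊓ comap (fun z : ℕ × ℕ => (z.2 : ℝ) / z.1) (𝓝 p)) (𝓝 L))
    (hcg : ∀ᶠ z : ℕ × ℕ in comap Prod.fst atTop ⊓ comap (fun z : ℕ × ℕ => (z.2 : ℝ) / z.1) (𝓝 p),
      c z.1 z.2 = (z.1.choose z.2 : ℝ) * p ^ z.2 * (1 - p) ^ (z.1 - z.2) * g z) :
    Tendsto (fun N => ∑ j ∈ Finset.range (N + 1), c N j) atTop (𝓝 L) := by
  rw [Metric.tendsto_nhds]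
  intro ε hε
  have hnear := (hg.eventually (Metric.closedBall_mem_nhds L (half_pos hε))).and hcg
  obtain ⟨⟨N₀, δ⟩, ⟨-, hδ⟩, hsub⟩ :=
    ((atTop_basis.comap Prod.fst).inf (Metric.nhds_basis_ball.comap _)).mem_iff.1 hnear
  have hvar : ∀ᶠ N : ℕ in atTop, (δ ^ 2)⁻¹ * (p * (1 - p) / N) < ε / 2 := by
    have hlim := (tendsto_const_div_atTop_nhds_zero_nat (p * (1 - p))).const_mul (δ ^ 2)⁻¹
    exact hlim.eventually_lt_const (by simpa using half_pos hε)
  filter_upwards [hc0, hc1, hvar, eventually_ge_atTop N₀, eventually_ne_atTop 0]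
    with N h0 h1 hv hN₀ hN
  have hterm (j : ℕ) : |c N j - (N.choose j : ℝ) * p ^ j * (1 - p) ^ (N - j) * L|
      ≤ (N.choose j : ℝ) * p ^ j * (1 - p) ^ (N - j) * (ε / 2)
        + (δ ^ 2)⁻¹ *
          ((N.choose j : ℝ) * p ^ j * (1 - p) ^ (N - j) * ((j : ℝ) / N - p) ^ 2) := by
    have hw : 0 ≤ (N.choose j : ℝ) * p ^ j * (1 - p) ^ (N - j) := (h0 j).trans (h1 j)
    have hcw := h1 j
    have hc := h0 j
    by_cases hj : |(j : ℝ) / N - p| < δ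
    · obtain ⟨hgL, hcj⟩ := hsub (a := (N, j)) ⟨hN₀, hj⟩
      simp only at hcj
      rw [Real.dist_eq] at hgL
      rw [hcj, ← mul_sub, abs_mul, abs_of_nonneg hw]
      refine le_add_of_le_of_nonneg (mul_le_mul_of_nonneg_left hgL hw) ?_
      exact mul_nonneg (by positivity) (mul_nonneg hw (sq_nonneg _))
    · set w := (N.choose j : ℝ) * p ^ j * (1 - p) ^ (N - j)
      have hone : 1 ≤ (δ ^ 2)⁻¹ * ((j : ℝ) / N - p) ^ 2 := by
        rw [inv_mul_eq_div, one_le_div (pow_pos hδ 2), ← sq_abs ((j : ℝ) / N - p)]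
        exact pow_le_pow_left₀ hδ.le (not_lt.1 hj) 2
      have hwL : w * L ≤ w := mul_le_of_le_one_right hw hL.2
      have hwL0 : 0 ≤ w * L := mul_nonneg hw hL.1
      calc |c N j - w * L| ≤ w := abs_le.2 ⟨by linarith, by linarith⟩
        _ ≤ w * ((δ ^ 2)⁻¹ * ((j : ℝ) / N - p) ^ 2) := le_mul_of_one_le_right hw hone
        _ = (δ ^ 2)⁻¹ * (w * ((j : ℝ) / N - p) ^ 2) := by ring
        _ ≤ _ := le_add_of_nonneg_left (mul_nonneg hw (half_pos hε).le)
  have hsum := sum_binomial_eq_one p N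
  rw [Real.dist_eq]
  calc |∑ j ∈ Finset.range (N + 1), c N j - L|
      = |∑ j ∈ Finset.range (N + 1),
          (c N j - (N.choose j : ℝ) * p ^ j * (1 - p) ^ (N - j) * L)| := by
        rw [Finset.sum_sub_distrib, ← Finset.sum_mul, hsum, one_mul]
    _ ≤ ∑ j ∈ Finset.range (N + 1),
          |c N j - (N.choose j : ℝ) * p ^ j * (1 - p) ^ (N - j) * L| :=
        Finset.abs_sum_le_sum_abs _ _
    _ ≤ _ := Finset.sum_le_sum fun j _ => hterm j
    _ = ε / 2 + (δ ^ 2)⁻¹ * (p * (1 - p) / N) := by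
        rw [Finset.sum_add_distrib, ← Finset.sum_mul, hsum, one_mul, ← Finset.mul_sum,
          sum_binomial_mul_sq hp hN]
    _ < ε := by linarith

/-- Fix `α ∈ (0,1)` and an absolutely continuous distribution `F` with
continuous density `f`, strictly positive at `q = F⁻¹(1−α)`.  For each `N ≥ 2`, let `n_N` be
binomial with parameters `N` and `1−α`, and conditionally on `n_N = n` with `1 ≤ n ≤ N−1`,
let `R_N` be distributed as the spacing `Z_(n+1) − Z_(n)` of an i.i.d. `N`-sample from `F`
(whose density for `δ > 0` is
`δ ↦ N!/((n−1)!(N−n−1)!) ∫ F(x)^{n−1} f(x) f(x+δ)(1−F(x+δ))^{N−n−1} dx`).  Then `N · R_N`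
converges in distribution to the exponential law with parameter `f(q)` (expressed via
pointwise convergence of the distribution functions). -/
theorem stmt_16 {Ω : Type*} [MeasurableSpace Ω] (μ : Measure Ω) [IsProbabilityMeasure μ]
    (α : ℝ) (hα : α ∈ Set.Ioo (0 : ℝ) 1)
    (f : ℝ → ℝ) (hf0 : ∀ x, 0 ≤ f x) (hf1 : ∫ x, f x = 1) (hfcont : Continuous f)
    (F : ℝ → ℝ) (hF : ∀ x, F x = ∫ u in Set.Iic x, f u)
    (q : ℝ) (hq : F q = 1 - α) (hfq : 0 < f q)
    (nn : ℕ → Ω → ℕ) (R : ℕ → Ω → ℝ)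
    (hnn : ∀ N : ℕ, 2 ≤ N → ∀ j : ℕ,
      μ {ω | nn N ω = j}
        = ENNReal.ofReal ((N.choose j : ℝ) * (1 - α) ^ j * α ^ (N - j)))
    (hR : ∀ N n : ℕ, 2 ≤ N → 1 ≤ n → n ≤ N - 1 → ∀ x : ℝ,
      μ {ω | R N ω ≤ x ∧ nn N ω = n}
        = μ {ω | nn N ω = n} *
            ENNReal.ofReal (∫ δ in Set.Iic x,
              (Set.Ioi (0 : ℝ)).indicator
                (fun δ =>
                  ((N.factorial : ℝ) /
                      (((n - 1).factorial : ℝ) * ((N - n - 1).factorial : ℝ))) *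
                    ∫ u : ℝ, F u ^ (n - 1) * f u * f (u + δ) * (1 - F (u + δ)) ^ (N - n - 1))
                δ)) :
    ∀ x : ℝ,
      Tendsto (fun N : ℕ => (μ {ω | (N : ℝ) * R N ω ≤ x}).toReal)
        atTop (𝓝 ((expMeasure (f q) (Set.Iic x)).toReal)) := by
  intro x
  have h := HasContinuousDensity.of_integral_eq_one hf0 hf1 hfcont hF
  have hp : F q ∈ Set.Ioo (0 : ℝ) 1 := by
    rw [hq]
    exact ⟨by linarith [hα.2], by linarith [hα.1]⟩
  have hα' : α = 1 - F q := by rw [hq]; ring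
  have hp' : 1 - α = F q := hq.symm
  simp only [hp'] at hnn
  have hw (N j : ℕ) : 0 ≤ (N.choose j : ℝ) * F q ^ j * (1 - F q) ^ (N - j) :=
    mul_nonneg (mul_nonneg (Nat.cast_nonneg _) (pow_nonneg hp.1.le _))
      (pow_nonneg (sub_nonneg.2 hp.2.le) _)
  simp only [hα'] at hnn
  have hexp : IsProbabilityMeasure (expMeasure (f q)) := isProbabilityMeasure_expMeasure hfq
  have hL : (expMeasure (f q) (Set.Iic x)).toReal ∈ Set.Icc (0 : ℝ) 1 :=
    ⟨ENNReal.toReal_nonneg, measureReal_le_one⟩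
  set l : Filter (ℕ × ℕ) :=
    comap Prod.fst atTop ⊓ comap (fun z : ℕ × ℕ => (z.2 : ℝ) / z.1) (𝓝 (F q))
  have hN : Tendsto (Prod.fst : ℕ × ℕ → ℕ) l atTop := tendsto_comap.mono_left inf_le_left
  have hn : Tendsto (fun z : ℕ × ℕ => (z.2 : ℝ) / z.1) l (𝓝 (F q)) :=
    tendsto_comap.mono_left inf_le_right
  have hset {N : ℕ} (hpos : 0 < N) : {ω | (N : ℝ) * R N ω ≤ x} = {ω | R N ω ≤ x / N} := by
    ext ω
    exact (le_div_iff₀' (Nat.cast_pos.2 hpos : (0 : ℝ) < N)).symm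
  have hmix := tendsto_binomial_mixture (Set.Ioo_subset_Icc_self hp) hL
    (c := fun N j => (μ ({ω | (N : ℝ) * R N ω ≤ x} ∩ {ω | nn N ω = j})).toReal)
    (.of_forall fun N j => ENNReal.toReal_nonneg)
    (by
      filter_upwards [eventually_ge_atTop 2] with N hN2 j
      refine ENNReal.toReal_le_of_le_ofReal (hw N j) ?_
      rw [← hnn N hN2 j]
      exact measure_mono Set.inter_subset_right)
    ((ENNReal.tendsto_toReal ENNReal.ofReal_ne_top).comp
      (ENNReal.tendsto_ofReal (h.tendsto_spacing_cdf hp hfq hN hn x)) |>.trans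
        (by rw [ENNReal.toReal_ofReal hL.1]))
    (by
      filter_upwards [HasContinuousDensity.eventually_one_le_lt hN hp hn,
        hN.eventually_ge_atTop 2] with z hz hz2
      rw [hset (by omega)]
      have hRz := hR z.1 z.2 hz2 hz.1 (by omega) (x / z.1)
      rw [← Set.ofPred_and, hRz, hnn z.1 hz2 z.2, ENNReal.toReal_mul,
        ENNReal.toReal_ofReal (hw z.1 z.2)]
      rfl)
  refine hmix.congr' ?_
  filter_upwards [eventually_ge_atTop 2] with N hN2
  rw [measure_eq_sum_inter_fiber (X := nn N) (s := Finset.range (N + 1)) ?_ ?_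
    {ω | (N : ℝ) * R N ω ≤ x}, ENNReal.toReal_sum fun j _ => measure_ne_top μ _]
  · intro j hj
    rw [hnn N hN2 j, Nat.choose_eq_zero_of_lt (by simpa using hj)]
    simp
  · rw [Finset.sum_congr rfl fun j _ => hnn N hN2 j,
      ← ENNReal.ofReal_sum_of_nonneg fun j _ => hw N j, sum_binomial_eq_one, ENNReal.ofReal_one]
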